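/- Assume Condition (D). For all f, g ∈ C_c²(E) the energy-measure identity holds: 2·E(g·f, g) − E(g², f) = 2 Σ_{∅≠B⊆I} Σ_{i∈B} ∫_{E_+(B)} f · (∂_i g)² · ϱ dλ_B^{n,s}; i.e., the energy measure of g ∈ C_c²(E) is ν_{⟨g⟩} = 2 Σ_{∅≠B⊆I} Σ_{i∈B} (∂_i g)² · ϱ λ_B^{n,s} restricted to E_+(B). -/

import Mathlib

open MeasureTheory ENNReal Set Filter
open scoped Classical

noncomputable section

variable {ι : Type*} [Fintype ι]

/-- Partial derivative of `f` in the `i`-th coordinate direction. -/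
def pderiv' (i : ι) (f : (ι → ℝ) → ℝ) (x : ι → ℝ) : ℝ :=
  fderiv ℝ f x (Pi.single i 1)

/-- The measure `λ_B^{(n)}`: product of Lebesgue measure on `[0,∞)` in coordinates in `B`
and Dirac measure at `0` in the remaining coordinates. -/
def lamB (B : Finset ι) : Measure (ι → ℝ) :=
  Measure.pi (fun i => if i ∈ B then volume.restrict (Set.Ici (0 : ℝ)) else Measure.dirac 0)

/-- The measure `λ_B^{n,s} = s^(n - #B) · λ_B^{(n)}`. -/
def lamBs (s : ℝ) (B : Finset ι) : Measure (ι → ℝ) :=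
  (ENNReal.ofReal (s ^ (Fintype.card ι - B.card))) • lamB B

/-- The measure `m_{n,s} = Σ_{B ⊆ I} λ_B^{n,s}`. -/
def mns (ι : Type*) [Fintype ι] (s : ℝ) : Measure (ι → ℝ) :=
  ∑ B : Finset ι, lamBs s B

/-- The measure `μ_{n,s,ϱ} = ϱ · m_{n,s}`. -/
def muM (s : ℝ) (ϱ : (ι → ℝ) → ℝ) : Measure (ι → ℝ) :=
  (mns ι s).withDensity (fun x => ENNReal.ofReal (ϱ x))

/-- The state space `E = [0,∞)^n`. -/
def Esp (ι : Type*) [Fintype ι] : Set (ι → ℝ) := {x | ∀ i, 0 ≤ x i}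

/-- `E_+(B) = {x ∈ E | x_i > 0 for i ∈ B, x_i = 0 for i ∉ B}`. -/
def Eplus (B : Finset ι) : Set (ι → ℝ) := {x | (∀ i ∈ B, 0 < x i) ∧ ∀ i ∉ B, x i = 0}

/-- Euclidean distance on `ι → ℝ`. -/
def distE (x y : ι → ℝ) : ℝ := Real.sqrt (∑ i, (x i - y i) ^ 2)

/-- The set `R_ϱ(cl E_+(B))` of points near which `ϱ⁻¹` is `λ_B^{n,s}`-integrable. -/
def Rset (s : ℝ) (ϱ : (ι → ℝ) → ℝ) (B : Finset ι) : Set (ι → ℝ) :=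
  {x ∈ closure (Eplus B) | ∃ ε > 0,
    ∫⁻ y in {y ∈ closure (Eplus B) | distE x y ≤ ε}, ENNReal.ofReal ((ϱ y)⁻¹) ∂(lamBs s B) < ⊤}

/-- The Hamza condition (Condition (H)). -/
def CondH (s : ℝ) (ϱ : (ι → ℝ) → ℝ) : Prop :=
  ∀ B : Finset ι, B.Nonempty →
    ∀ᵐ x ∂((lamBs s B).restrict (closure (Eplus B) \ Rset s ϱ B)), ϱ x = 0

/-- The pre-Dirichlet form `E(f,g) = Σ_{∅≠B⊆I} Σ_{i∈B} ∫_{E_+(B)} ∂_i f ∂_i g ϱ dλ_B^{n,s}`. -/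
def dirForm (s : ℝ) (ϱ f g : (ι → ℝ) → ℝ) : ℝ :=
  ∑ B : Finset ι, ∑ i ∈ B, ∫ x in Eplus B, pderiv' i f x * pderiv' i g x * ϱ x ∂(lamBs s B)

end

theorem pderiv'_mul {ι : Type*} [Fintype ι] (i : ι) {f g : (ι → ℝ) → ℝ} {x : ι → ℝ}
    (hf : DifferentiableAt ℝ f x) (hg : DifferentiableAt ℝ g x) :
    pderiv' i (fun y => f y * g y) x = f x * pderiv' i g x + g x * pderiv' i f x := by
  simp [pderiv', fderiv_fun_mul hf hg]

theorem pderiv'_sq {ι : Type*} [Fintype ι] (i : ι) {g : (ι → ℝ) → ℝ} {x : ι → ℝ} (hg : DifferentiableAt ℝ g x) :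
    pderiv' i (fun y => g y ^ 2) x = 2 * g x * pderiv' i g x := by
  simp only [pow_two, pderiv'_mul i hg hg]
  ring

theorem continuous_pderiv' {ι : Type*} [Fintype ι] (i : ι) {f : (ι → ℝ) → ℝ} (hf : ContDiff ℝ 1 f) :
    Continuous (pderiv' i f) :=
  (hf.continuous_fderiv one_ne_zero).clm_apply continuous_const

theorem lamBs_le_mns {ι : Type*} [Fintype ι] (s : ℝ) (B : Finset ι) : lamBs s B ≤ mns ι s :=
  Finset.single_le_sum (f := fun B : Finset ι => lamBs s B)
    (fun _ _ => Measure.zero_le _) (Finset.mem_univ B)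

/-- A continuous compactly supported function times an integrable one is integrable. -/
theorem Continuous.integrable_mul_of_hasCompactSupport {X : Type*} [TopologicalSpace X]
    [MeasurableSpace X] [OpensMeasurableSpace X] {μ : Measure X} {h ϱ : X → ℝ}
    (hh : Continuous h) (hc : HasCompactSupport h) (hϱ : Integrable ϱ μ) :
    Integrable (fun x => h x * ϱ x) μ := by
  obtain ⟨C, hC⟩ := hc.exists_bound_of_continuous hh
  exact hϱ.bdd_mul hh.aestronglyMeasurable (ae_of_all _ hC)

/-- the energy-measure identity for the pre-Dirichlet form. -/
theorem energy_measure_identity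
    (n : ℕ) (s : ℝ) (hs : 0 < s) (ϱ : (Fin n → ℝ) → ℝ)
    (hmeas : Measurable ϱ) (hnn : ∀ x, 0 ≤ ϱ x)
    (hpos : ∀ᵐ x ∂(mns (Fin n) s), 0 < ϱ x)
    (hint : Integrable ϱ (mns (Fin n) s))
    (f g : (Fin n → ℝ) → ℝ)
    (hf : ContDiff ℝ 2 f ∧ HasCompactSupport f)
    (hg : ContDiff ℝ 2 g ∧ HasCompactSupport g) :
    2 * dirForm s ϱ (fun x => g x * f x) g - dirForm s ϱ (fun x => g x ^ 2) f
      = 2 * ∑ B : Finset (Fin n), ∑ i ∈ B,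
          ∫ x in Eplus B, f x * (pderiv' i g x) ^ 2 * ϱ x ∂(lamBs s B) := by
  obtain ⟨hf, -⟩ := hf
  obtain ⟨hg, hgc⟩ := hg
  have hfd : Differentiable ℝ f := hf.differentiable two_ne_zero
  have hgd : Differentiable ℝ g := hg.differentiable two_ne_zero
  have hf' (i) : Continuous (pderiv' i f) := continuous_pderiv' i (hf.of_le one_le_two)
  have hg' (i) : Continuous (pderiv' i g) := continuous_pderiv' i (hg.of_le one_le_two)
  have hgc' (i) : HasCompactSupport (pderiv' i g) := hgc.fderiv_apply ℝ _
  simp only [dirForm, Finset.mul_sum, ← Finset.sum_sub_distrib]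
  refine Finset.sum_congr rfl fun B _ => Finset.sum_congr rfl fun i _ => ?_
  have hϱ : Integrable ϱ ((lamBs s B).restrict (Eplus B)) :=
    (hint.mono_measure (lamBs_le_mns s B)).restrict
  have h₁ : Integrable (fun x => (g x * pderiv' i f x + f x * pderiv' i g x) * pderiv' i g x * ϱ x)
      ((lamBs s B).restrict (Eplus B)) :=
    Continuous.integrable_mul_of_hasCompactSupport
      (((hgd.continuous.mul (hf' i)).add (hfd.continuous.mul (hg' i))).mul (hg' i))
      ((hgc' i).mul_left) hϱ
  have h₂ : Integrable (fun x => 2 * g x * pderiv' i g x * pderiv' i f x * ϱ x)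
      ((lamBs s B).restrict (Eplus B)) :=
    Continuous.integrable_mul_of_hasCompactSupport
      (((continuous_const.mul hgd.continuous).mul (hg' i)).mul (hf' i))
      (((hgc' i).mul_left).mul_right) hϱ
  simp only [pderiv'_mul i (hgd _) (hfd _), pderiv'_sq i (hgd _)]
  rw [← integral_const_mul, ← integral_const_mul, ← integral_sub (h₁.const_mul 2) h₂]
  congr 1 with x
  ring
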